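/- arXiv:2006.10360 — 2 statements merged into one kernel-verified Lean document; each statement's English description precedes it below -/
import Mathlib

section
/- Let Ω ⊂ ℝ^n (n ≥ 2) be a bounded open set admitting a Green function G, let a, b ∈ Ω be distinct, and assume the polarized energy-momentum tensor T of G formed from the pair a, b is locally integrable on Ω. Then the distributional divergence of T has exactly two point sources: for each index i ∈ {1,…,n} and every smooth compactly supported φ : Ω → ℝ, ∫_Ω ∑_{j=1}^n T_{ij}(x) ∂_j φ(x) dx = φ(b) · ∂_{x_i} G(x,a)|_{x=b} + φ(a) · ∂_{x_i} G(x,b)|_{x=a}; equivalently, ∑_j ∂_j T_{ij} = −∂_{x_i}G(·,a)(b) δ_b − ∂_{x_i}G(·,b)(a) δ_a as distributions on Ω. -/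
open MeasureTheory
open scoped BigOperators

/-- The partial derivative `∂f/∂xᵢ` of a function on Euclidean space. -/
noncomputable def pd {n : ℕ} (f : EuclideanSpace ℝ (Fin n) → ℝ) (i : Fin n)
    (x : EuclideanSpace ℝ (Fin n)) : ℝ :=
  fderiv ℝ f x (EuclideanSpace.single i 1)

/-- The Laplacian `Δf = ∑ᵢ ∂²f/∂xᵢ²`. -/
noncomputable def lap {n : ℕ} (f : EuclideanSpace ℝ (Fin n) → ℝ)
    (x : EuclideanSpace ℝ (Fin n)) : ℝ :=
  ∑ i, pd (pd f i) i x

/-- `G` is a Green function for the (bounded, open) set `Ω ⊆ ℝ^n`: for each pole `a ∈ Ω`,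
`G(·,a)` is smooth off the pole and locally integrable, satisfies `−ΔG(·,a) = δ_a` in the
distributional sense, and extends continuously to `cl(Ω) \ {a}` with value `0` on `∂Ω`. -/
structure IsGreen (n : ℕ) (Ω : Set (EuclideanSpace ℝ (Fin n)))
    (G : EuclideanSpace ℝ (Fin n) → EuclideanSpace ℝ (Fin n) → ℝ) : Prop where
  smooth : ∀ a ∈ Ω, ContDiffOn ℝ (⊤ : ℕ∞) (fun x => G x a) (Ω \ {a})
  locInt : ∀ a ∈ Ω, LocallyIntegrableOn (fun x => G x a) Ω volume
  distrib : ∀ a ∈ Ω, ∀ φ : EuclideanSpace ℝ (Fin n) → ℝ,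
      ContDiff ℝ (⊤ : ℕ∞) φ → HasCompactSupport φ → tsupport φ ⊆ Ω →
      (∫ x in Ω, G x a * lap φ x) = -φ a
  boundary : ∀ a ∈ Ω, ∃ Gbar : EuclideanSpace ℝ (Fin n) → ℝ,
      ContinuousOn Gbar (closure Ω \ {a}) ∧
      (∀ x ∈ Ω \ {a}, Gbar x = G x a) ∧
      (∀ x ∈ frontier Ω, Gbar x = 0)

local notation "𝔈" n:max => EuclideanSpace ℝ (Fin n)

/-- `φ` is a test function on `U`: smooth with compact support contained in `U`. -/
structure IsTest {n : ℕ} (U : Set (𝔈 n)) (φ : (𝔈 n) → ℝ) : Prop where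
  smooth : ContDiff ℝ (⊤ : ℕ∞) φ
  compact : HasCompactSupport φ
  sub : tsupport φ ⊆ U

section Calculus

variable {n : ℕ} {U : Set (𝔈 n)} {f g φ : (𝔈 n) → ℝ} {i j : Fin n} {x : 𝔈 n}

lemma ContDiffOn.pd (hU : IsOpen U) (hf : ContDiffOn ℝ (⊤ : ℕ∞) f U) (i : Fin n) :
    ContDiffOn ℝ (⊤ : ℕ∞) (pd f i) U :=
  (hf.fderiv_of_isOpen hU (m := (⊤ : ℕ∞)) (by simp)).clm_apply contDiffOn_const

lemma ContDiff.pd (hf : ContDiff ℝ (⊤ : ℕ∞) f) (i : Fin n) : ContDiff ℝ (⊤ : ℕ∞) (pd f i) :=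
  contDiffOn_univ.1 (hf.contDiffOn.pd isOpen_univ i)

lemma ContDiffOn.differentiableAt_of_isOpen (hU : IsOpen U) (hf : ContDiffOn ℝ (⊤ : ℕ∞) f U)
    (hx : x ∈ U) : DifferentiableAt ℝ f x :=
  (hf.contDiffAt (hU.mem_nhds hx)).differentiableAt (by simp)

lemma pd_congr (hU : IsOpen U) (h : Set.EqOn f g U) (i : Fin n) : Set.EqOn (pd f i) (pd g i) U :=
  fun x hx => by
    unfold _root_.pd
    rw [(Filter.eventuallyEq_of_mem (hU.mem_nhds hx) h).fderiv_eq]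

lemma pd_mul (hf : DifferentiableAt ℝ f x) (hg : DifferentiableAt ℝ g x) (i : Fin n) :
    pd (fun y => f y * g y) i x = pd f i x * g x + f x * pd g i x := by
  unfold pd
  rw [fderiv_fun_mul hf hg]
  simp
  ring

lemma pd_add (hf : DifferentiableAt ℝ f x) (hg : DifferentiableAt ℝ g x) (i : Fin n) :
    pd (fun y => f y + g y) i x = pd f i x + pd g i x := by
  unfold pd
  rw [fderiv_fun_add hf hg]
  simp

lemma pd_sum {ι : Type*} {s : Finset ι} {F : ι → (𝔈 n) → ℝ}
    (hF : ∀ k ∈ s, DifferentiableAt ℝ (F k) x) (i : Fin n) :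
    pd (fun y => ∑ k ∈ s, F k y) i x = ∑ k ∈ s, pd (F k) i x := by
  unfold pd
  rw [fderiv_fun_sum hF]
  simp

lemma pd_comm (hU : IsOpen U) (hf : ContDiffOn ℝ (⊤ : ℕ∞) f U) (hx : x ∈ U) (i j : Fin n) :
    pd (pd f i) j x = pd (pd f j) i x := by
  have hd : DifferentiableAt ℝ (fderiv ℝ f) x :=
    ((hf.fderiv_of_isOpen hU (m := (⊤ : ℕ∞)) (by simp)).contDiffAt
      (hU.mem_nhds hx)).differentiableAt (by simp)
  have key : ∀ k l : Fin n, pd (pd f k) l x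
      = fderiv ℝ (fderiv ℝ f) x (EuclideanSpace.single l 1) (EuclideanSpace.single k 1) := by
    intro k l
    change fderiv ℝ (fun y => fderiv ℝ f y (EuclideanSpace.single k 1)) x _ = _
    rw [fderiv_clm_apply hd (differentiableAt_const _)]
    simp
  rw [key, key]
  exact ((hf.contDiffAt (hU.mem_nhds hx)).isSymmSndFDerivAt
    (by simpa using WithTop.coe_le_coe.2 (le_top : (2 : ℕ∞) ≤ ⊤))).eq _ _

lemma lap_mul (hU : IsOpen U) (hf : ContDiffOn ℝ (⊤ : ℕ∞) f U) (hg : ContDiffOn ℝ (⊤ : ℕ∞) g U)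
    (hx : x ∈ U) :
    lap (fun y => f y * g y) x
      = lap f x * g x + 2 * ∑ k, pd f k x * pd g k x + f x * lap g x := by
  have h1 : ∀ k, pd (pd (fun y => f y * g y) k) k x
      = pd (pd f k) k x * g x + 2 * (pd f k x * pd g k x) + f x * pd (pd g k) k x := by
    intro k
    have df := fun y hy => hf.differentiableAt_of_isOpen hU (x := y) hy
    have dg := fun y hy => hg.differentiableAt_of_isOpen hU (x := y) hy
    have df' := (hf.pd hU k).differentiableAt_of_isOpen hU hx
    have dg' := (hg.pd hU k).differentiableAt_of_isOpen hU hx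
    rw [pd_congr hU (fun y hy => pd_mul (df y hy) (dg y hy) k) k hx,
      pd_add (f := fun y => pd f k y * g y) (g := fun y => f y * pd g k y)
        (df'.mul (dg x hx)) ((df x hx).mul dg'), pd_mul df' (dg x hx),
      pd_mul (df x hx) dg']
    ring
  simp only [lap, h1, Finset.sum_add_distrib, Finset.mul_sum, Finset.sum_mul]

lemma tsupport_pd_subset (f : (𝔈 n) → ℝ) (i : Fin n) : tsupport (pd f i) ⊆ tsupport f :=
  tsupport_fderiv_apply_subset ℝ _

namespace IsTest

lemma pd (hφ : IsTest U φ) (i : Fin n) : IsTest U (pd φ i) where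
  smooth := hφ.smooth.pd i
  compact := hφ.compact.mono' (subset_closure.trans (tsupport_pd_subset φ i))
  sub := (tsupport_pd_subset φ i).trans hφ.sub

lemma mono {V : Set (𝔈 n)} (hφ : IsTest U φ) (h : U ⊆ V) : IsTest V φ :=
  ⟨hφ.smooth, hφ.compact, hφ.sub.trans h⟩

lemma eq_zero (hφ : IsTest U φ) (hx : x ∉ U) : φ x = 0 :=
  image_eq_zero_of_notMem_tsupport fun h => hx (hφ.sub h)

lemma mul (hφ : IsTest U φ) (hU : IsOpen U) (hf : ContDiffOn ℝ (⊤ : ℕ∞) f U) :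
    IsTest U (fun x => f x * φ x) where
  smooth := by
    rw [contDiff_iff_contDiffAt]
    intro x
    by_cases hx : x ∈ tsupport φ
    · exact (hf.contDiffAt (hU.mem_nhds (hφ.sub hx))).mul hφ.smooth.contDiffAt
    · refine (contDiffAt_const (c := (0 : ℝ))).congr_of_eventuallyEq ?_
      filter_upwards [notMem_tsupport_iff_eventuallyEq.1 hx] with y hy
      simp [hy]
  compact := hφ.compact.mul_left
  sub := (tsupport_mul_subset_right).trans hφ.sub

lemma add (hφ : IsTest U φ) (hf : IsTest U f) : IsTest U (fun x => φ x + f x) where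
  smooth := hφ.smooth.add hf.smooth
  compact := hφ.compact.add hf.compact
  sub := (tsupport_add _ _).trans (Set.union_subset hφ.sub hf.sub)

lemma zero : IsTest U (fun _ => (0 : ℝ)) where
  smooth := contDiff_const
  compact := HasCompactSupport.zero
  sub := by simp [tsupport]

lemma sum {ι : Type*} {s : Finset ι} {F : ι → (𝔈 n) → ℝ} (h : ∀ k ∈ s, IsTest U (F k)) :
    IsTest U (fun x => ∑ k ∈ s, F k x) := by
  classical
  induction s using Finset.induction_on with
  | empty => simpa using zero
  | insert k s hk ih =>
    simp only [Finset.sum_insert hk]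
    exact (h k (by simp)).add (ih fun l hl => h l (by simp [hl]))

lemma lap (hφ : IsTest U φ) : IsTest U (lap φ) := sum fun k _ => (hφ.pd k).pd k

lemma continuous (hφ : IsTest U φ) : Continuous φ := hφ.smooth.continuous

lemma integrable_mul (hφ : IsTest U φ) (hU : IsOpen U) (hf : LocallyIntegrableOn f U) :
    Integrable (fun x => f x * φ x) := by
  have h : IntegrableOn (fun x => f x * φ x) (tsupport φ) :=
    IntegrableOn.mul_continuousOn ((locallyIntegrableOn_iff hU.isLocallyClosed).1 hf _ hφ.sub
      hφ.compact) hφ.continuous.continuousOn hφ.compact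
  refine (integrableOn_iff_integrable_of_support_subset fun x hx => ?_).1 h
  exact subset_closure (right_ne_zero_of_mul hx)

end IsTest

lemma integral_mul_pd (hU : IsOpen U) (hf : ContDiffOn ℝ (⊤ : ℕ∞) f U) (hφ : IsTest U φ)
    (i : Fin n) : ∫ x, f x * pd φ i x = -∫ x, pd f i x * φ x :=
  integral_mul_fderiv_eq_neg_fderiv_mul_of_integrable
    (hφ.integrable_mul hU ((hf.pd hU i).continuousOn.locallyIntegrableOn hU.measurableSet))
    ((hφ.pd i).integrable_mul hU (hf.continuousOn.locallyIntegrableOn hU.measurableSet))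
    (hφ.integrable_mul hU (hf.continuousOn.locallyIntegrableOn hU.measurableSet))
    (fun _ hx => hf.differentiableAt_of_isOpen hU (hφ.sub hx))
    (fun _ _ => hφ.smooth.contDiffAt.differentiableAt (by simp))

end Calculus

section Kernel

variable {n : ℕ} {φ : (𝔈 n) → ℝ}

/-- For `δ = 0` this is the gradient `xⱼ / |x|ⁿ` of the (unnormalized) Newtonian potential on `ℝⁿ`;
positive `δ` gives a smooth regularization. -/
noncomputable def newtonKernel (n : ℕ) (δ : ℝ) (j : Fin n) (x : 𝔈 n) : ℝ :=
  x j * (‖x‖ ^ 2 + δ ^ 2) ^ (-(n : ℝ) / 2)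

/-- The divergence of the regularized kernel at scale `δ = 1`. -/
noncomputable def newtonBump (n : ℕ) (x : 𝔈 n) : ℝ :=
  n * (1 + ‖x‖ ^ 2) ^ (-((n : ℝ) + 2) / 2)

lemma newtonKernel_neg (j : Fin n) (δ : ℝ) (x : 𝔈 n) :
    newtonKernel n δ j (-x) = -newtonKernel n δ j x := by
  simp [newtonKernel]

lemma contDiff_newtonKernel {δ : ℝ} (hδ : 0 < δ) (j : Fin n) :
    ContDiff ℝ (⊤ : ℕ∞) (newtonKernel n δ j) := by
  refine ContDiff.mul (EuclideanSpace.proj (𝕜 := ℝ) j).contDiff ?_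
  exact ((contDiff_norm_sq ℝ).add contDiff_const).rpow_const_of_ne
    fun x => by positivity

lemma pd_newtonKernel {δ : ℝ} (hδ : 0 < δ) (j k : Fin n) (x : 𝔈 n) :
    pd (newtonKernel n δ j) k x = (if j = k then 1 else 0) * (‖x‖ ^ 2 + δ ^ 2) ^ (-(n : ℝ) / 2)
      - n * x j * x k * (‖x‖ ^ 2 + δ ^ 2) ^ (-(n : ℝ) / 2 - 1) := by
  have h1 : HasFDerivAt (fun y : 𝔈 n => y j) (EuclideanSpace.proj (𝕜 := ℝ) j) x :=
    (EuclideanSpace.proj (𝕜 := ℝ) j).hasFDerivAt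
  have h2 := ((hasStrictFDerivAt_norm_sq x).hasFDerivAt.add_const (δ ^ 2)).rpow_const
    (p := -(n : ℝ) / 2) (Or.inl (by positivity))
  have h3 := (h1.mul h2).fderiv
  change fderiv ℝ (newtonKernel n δ j) x = _ at h3
  unfold pd
  rw [h3]
  simp [EuclideanSpace.inner_single_right]
  split_ifs <;> ring

lemma sum_pd_newtonKernel {δ : ℝ} (hδ : 0 < δ) (x : 𝔈 n) :
    ∑ k, pd (newtonKernel n δ k) k x = δ⁻¹ ^ n * newtonBump n (δ⁻¹ • x) := by
  have hs : 0 < ‖x‖ ^ 2 + δ ^ 2 := by positivity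
  have hx : ∑ k, x k * x k = ‖x‖ ^ 2 := by
    rw [EuclideanSpace.norm_sq_eq]
    exact Finset.sum_congr rfl fun k _ => by rw [Real.norm_eq_abs, sq_abs, sq]
  have h1 : ∑ k, pd (newtonKernel n δ k) k x
      = n * δ ^ 2 * (‖x‖ ^ 2 + δ ^ 2) ^ (-(n : ℝ) / 2 - 1) := by
    have h2 : (‖x‖ ^ 2 + δ ^ 2) ^ (-(n : ℝ) / 2)
        = (‖x‖ ^ 2 + δ ^ 2) ^ (-(n : ℝ) / 2 - 1) * (‖x‖ ^ 2 + δ ^ 2) := by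
      rw [Real.rpow_sub_one hs.ne', div_mul_cancel₀ _ hs.ne']
    have h3 : ∀ k, pd (newtonKernel n δ k) k x = (‖x‖ ^ 2 + δ ^ 2) ^ (-(n : ℝ) / 2 - 1)
        * ((‖x‖ ^ 2 + δ ^ 2) - n * (x k * x k)) := by
      intro k
      rw [pd_newtonKernel hδ, if_pos rfl, h2]
      ring
    simp_rw [h3, ← Finset.mul_sum, Finset.sum_sub_distrib, ← Finset.mul_sum, hx]
    simp
    ring
  have h4 : ‖x‖ ^ 2 + δ ^ 2 = δ ^ 2 * (1 + ‖δ⁻¹ • x‖ ^ 2) := by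
    rw [norm_smul, Real.norm_of_nonneg (by positivity)]
    field_simp
    ring
  have h5 : (δ ^ 2) ^ (-((n : ℝ) + 2) / 2) = (δ ^ (n + 2))⁻¹ := by
    rw [← Real.rpow_natCast δ 2, ← Real.rpow_mul hδ.le, ← Real.rpow_natCast δ (n + 2),
      ← Real.rpow_neg hδ.le]
    congr 1
    push_cast
    ring
  rw [h1, newtonBump, show -(n : ℝ) / 2 - 1 = -((n : ℝ) + 2) / 2 by ring, h4,
    Real.mul_rpow (by positivity) (by positivity), h5, pow_add, inv_pow]
  field_simp

lemma locallyIntegrable_newtonBound (hn : n ≠ 0) :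
    LocallyIntegrable (fun x : 𝔈 n => ‖x‖ * (‖x‖ ^ 2) ^ (-(n : ℝ) / 2)) := by
  have : Nonempty (Fin n) := ⟨⟨0, Nat.pos_of_ne_zero hn⟩⟩
  have : Nontrivial (𝔈 n) := inferInstance
  rw [locallyIntegrable_iff]
  intro K hK
  obtain ⟨R, hR⟩ := hK.isBounded.subset_ball 0
  refine IntegrableOn.mono_set ?_ hR
  refine (integrableOn_fun_norm_addHaar volume
    (f := fun r : ℝ => r * (r ^ 2) ^ (-(n : ℝ) / 2))).2 ?_
  refine (integrableOn_const (C := (1 : ℝ)) (by simp)).congr_fun (fun r hr => ?_) measurableSet_Ioo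
  have hr0 : 0 < r := hr.1
  have : (r ^ 2) ^ (-(n : ℝ) / 2) = (r ^ n)⁻¹ := by
    rw [← Real.rpow_natCast r 2, ← Real.rpow_mul hr0.le, ← Real.rpow_natCast r n,
      ← Real.rpow_neg hr0.le]
    congr 1
    push_cast
    ring
  simp only [finrank_euclideanSpace, Fintype.card_fin, smul_eq_mul, this]
  rw [← mul_assoc, ← pow_succ, Nat.sub_add_cancel (Nat.pos_of_ne_zero hn), mul_inv_cancel₀]
  positivity

lemma abs_newtonKernel_le (δ : ℝ) (j : Fin n) (x : 𝔈 n) :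
    ‖newtonKernel n δ j x‖ ≤ ‖x‖ * (‖x‖ ^ 2) ^ (-(n : ℝ) / 2) := by
  rcases eq_or_ne x 0 with rfl | hx
  · simp [newtonKernel]
  have : 0 < ‖x‖ := norm_pos_iff.2 hx
  rw [newtonKernel, norm_mul, Real.norm_of_nonneg (r := _ ^ _) (by positivity)]
  refine mul_le_mul (PiLp.norm_apply_le x j) ?_ (by positivity) (by positivity)
  exact Real.rpow_le_rpow_of_nonpos (by positivity) (by nlinarith [sq_nonneg δ])
    (by have : (0 : ℝ) ≤ n := by positivity
        linarith)

lemma measurable_newtonKernel (δ : ℝ) (j : Fin n) : Measurable (newtonKernel n δ j) := by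
  unfold newtonKernel
  fun_prop

lemma locallyIntegrable_newtonKernel (δ : ℝ) (j : Fin n) :
    LocallyIntegrable (newtonKernel n δ j) :=
  (locallyIntegrable_newtonBound j.pos.ne').mono (measurable_newtonKernel δ j).aestronglyMeasurable
    (Filter.Eventually.of_forall fun x => (abs_newtonKernel_le δ j x).trans (le_abs_self _))

lemma tendsto_newtonKernel (j : Fin n) (x : 𝔈 n) :
    Filter.Tendsto (fun c : ℝ => newtonKernel n c⁻¹ j x) Filter.atTop
      (nhds (newtonKernel n 0 j x)) := by
  rcases eq_or_ne x 0 with rfl | hx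
  · simp [newtonKernel]
  have : 0 < ‖x‖ := norm_pos_iff.2 hx
  have h : Filter.Tendsto (fun c : ℝ => ‖x‖ ^ 2 + c⁻¹ ^ 2) Filter.atTop
      (nhds (‖x‖ ^ 2 + 0 ^ 2)) := (tendsto_inv_atTop_zero.pow 2).const_add _
  exact (h.rpow_const (Or.inl (by positivity))).const_mul _

lemma integral_newtonKernel_mul_lap {δ : ℝ} (hδ : 0 < δ) (j : Fin n) (hφ : IsTest Set.univ φ) :
    ∫ x, newtonKernel n δ j x * lap φ x
      = -∫ x, (δ⁻¹ ^ n * newtonBump n (δ⁻¹ • x)) * pd φ j x := by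
  have hK := fun k => (contDiff_newtonKernel hδ k (n := n)).contDiffOn (s := Set.univ)
  have hli : ∀ {f : (𝔈 n) → ℝ}, ContDiffOn ℝ (⊤ : ℕ∞) f Set.univ →
      LocallyIntegrableOn f Set.univ :=
    fun hf => hf.continuousOn.locallyIntegrableOn MeasurableSet.univ
  have key : ∀ k, ∫ x, newtonKernel n δ j x * pd (pd φ k) k x
      = -∫ x, pd (newtonKernel n δ k) k x * pd φ j x := by
    intro k
    rw [integral_mul_pd isOpen_univ (hK j) (hφ.pd k),
      ← integral_mul_pd isOpen_univ (hK k) (hφ.pd j)]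
    have : ∀ x, pd (newtonKernel n δ j) k x = pd (newtonKernel n δ k) j x := by
      intro x
      simp only [pd_newtonKernel hδ, eq_comm]
      ring
    simp_rw [this, pd_comm isOpen_univ hφ.smooth.contDiffOn (Set.mem_univ _) j k]
    rw [integral_mul_pd isOpen_univ (hK k) (hφ.pd k)]
  simp_rw [lap, Finset.mul_sum, ← sum_pd_newtonKernel hδ, Finset.sum_mul]
  rw [integral_finsetSum _ fun k _ =>
      ((hφ.pd k).pd k).integrable_mul isOpen_univ (hli (hK j)),
    integral_finsetSum _ fun k _ =>
      (hφ.pd j).integrable_mul isOpen_univ (hli ((hK k).pd isOpen_univ k)),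
    ← Finset.sum_neg_distrib]
  exact Finset.sum_congr rfl fun k _ => key k

lemma integrable_newtonBump : Integrable (newtonBump n) :=
  (integrable_rpow_neg_one_add_norm_sq (r := (n : ℝ) + 2) (by simp)).const_mul _

lemma newtonBump_pos (hn : n ≠ 0) (x : 𝔈 n) : 0 < newtonBump n x := by
  have : 0 < n := Nat.pos_of_ne_zero hn
  unfold newtonBump
  positivity

lemma integral_newtonBump_pos (hn : n ≠ 0) : 0 < ∫ x, newtonBump n x := by
  rw [integral_pos_iff_support_of_nonneg (fun x => (newtonBump_pos hn x).le) integrable_newtonBump]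
  have : Function.support (newtonBump n) = Set.univ :=
    Set.eq_univ_of_forall fun x => (newtonBump_pos hn x).ne'
  rw [this]
  exact isOpen_univ.measure_pos volume Set.univ_nonempty

lemma tendsto_norm_pow_mul_newtonBump (n : ℕ) :
    Filter.Tendsto (fun x => ‖x‖ ^ n * newtonBump n x) (Bornology.cobounded (𝔈 n)) (nhds 0) := by
  have h : Filter.Tendsto (fun x : 𝔈 n => (n : ℝ) * (‖x‖ ^ 2)⁻¹) (Bornology.cobounded _)
      (nhds (n * 0)) :=
    ((tendsto_inv_atTop_zero.comp
      ((Filter.tendsto_pow_atTop two_ne_zero).comp tendsto_norm_cobounded_atTop))).const_mul _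
  rw [mul_zero] at h
  refine squeeze_zero' (Filter.Eventually.of_forall fun x => ?_) ?_ h
  · unfold newtonBump
    positivity
  · filter_upwards [tendsto_norm_cobounded_atTop.eventually_gt_atTop (0 : ℝ)] with x hx
    have h1 : (1 + ‖x‖ ^ 2) ^ (-((n : ℝ) + 2) / 2) ≤ (‖x‖ ^ 2) ^ (-((n : ℝ) + 2) / 2) :=
      Real.rpow_le_rpow_of_nonpos (by positivity) (by linarith)
        (by have : (0 : ℝ) ≤ n := by positivity
            linarith)
    have h2 : (‖x‖ ^ 2) ^ (-((n : ℝ) + 2) / 2) = (‖x‖ ^ (n + 2))⁻¹ := by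
      rw [← Real.rpow_natCast ‖x‖ 2, ← Real.rpow_mul hx.le, ← Real.rpow_natCast ‖x‖ (n + 2),
        ← Real.rpow_neg hx.le]
      congr 1
      push_cast
      ring
    rw [h2] at h1
    calc ‖x‖ ^ n * newtonBump n x ≤ ‖x‖ ^ n * (n * (‖x‖ ^ (n + 2))⁻¹) := by
          unfold newtonBump
          gcongr
      _ = n * (‖x‖ ^ 2)⁻¹ := by
          rw [pow_add]
          field_simp

/-- In the sense of distributions, `Δ(xⱼ / |x|ⁿ)` is a multiple of `∂ⱼδ₀`. -/
lemma integral_newtonKernel_zero_mul_lap (j : Fin n) (hφ : IsTest Set.univ φ) :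
    ∫ x, newtonKernel n 0 j x * lap φ x = -((∫ x, newtonBump n x) * pd φ j 0) := by
  have hn : n ≠ 0 := j.pos.ne'
  set C := ∫ x, newtonBump n x with hC
  have hCpos : 0 < C := integral_newtonBump_pos hn
  have hlim1 : Filter.Tendsto (fun c : ℝ => ∫ x, newtonKernel n c⁻¹ j x * lap φ x) Filter.atTop
      (nhds (∫ x, newtonKernel n 0 j x * lap φ x)) := by
    refine tendsto_integral_filter_of_dominated_convergence
      (fun x => ‖(‖x‖ * (‖x‖ ^ 2) ^ (-(n : ℝ) / 2)) * lap φ x‖) ?_ ?_ ?_ ?_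
    · exact Filter.Eventually.of_forall fun c =>
        ((measurable_newtonKernel c⁻¹ j).mul hφ.lap.continuous.measurable).aestronglyMeasurable
    · refine Filter.Eventually.of_forall fun c => Filter.Eventually.of_forall fun x => ?_
      rw [norm_mul, norm_mul]
      gcongr
      exact (abs_newtonKernel_le _ j x).trans (le_abs_self _)
    · exact (hφ.lap.integrable_mul isOpen_univ
        ((locallyIntegrable_newtonBound hn).locallyIntegrableOn _)).norm
    · exact Filter.Eventually.of_forall fun x => (tendsto_newtonKernel j x).mul_const _
  have hlim2 := tendsto_integral_comp_smul_smul_of_integrable (μ := volume)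
    (φ := fun x : 𝔈 n => C⁻¹ * newtonBump n x) (g := pd φ j)
    (fun x => mul_nonneg (inv_nonneg.2 hCpos.le) (newtonBump_pos hn x).le)
    (by rw [integral_const_mul, ← hC, inv_mul_cancel₀ hCpos.ne'])
    (by
      have := (tendsto_norm_pow_mul_newtonBump n).const_mul C⁻¹
      rw [mul_zero] at this
      refine this.congr fun x => ?_
      rw [finrank_euclideanSpace, Fintype.card_fin]
      ring)
    ((hφ.pd j).continuous.integrable_of_hasCompactSupport (hφ.pd j).compact)
    (hφ.pd j).continuous.continuousAt
  have hlim3 := (hlim2.const_mul C).neg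
  refine tendsto_nhds_unique hlim1 (hlim3.congr' ?_)
  filter_upwards [Filter.eventually_gt_atTop (0 : ℝ)] with c hc
  rw [integral_newtonKernel_mul_lap (inv_pos.2 hc) j hφ, ← integral_const_mul]
  congr 2
  ext x
  rw [finrank_euclideanSpace, Fintype.card_fin, inv_inv, smul_eq_mul]
  field_simp

end Kernel
section Convolution

open scoped Convolution

variable {n : ℕ} {U : Set (𝔈 n)} {f φ K : (𝔈 n) → ℝ}

lemma contDiff_integral_mul_comp_sub (hK : LocallyIntegrable K) (hφ : IsTest U φ) :
    ContDiff ℝ (⊤ : ℕ∞) (fun x => ∫ t, K t * φ (x - t)) :=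
  hφ.compact.contDiff_convolution_right (ContinuousLinearMap.mul ℝ ℝ) hK hφ.smooth

lemma pd_integral_mul_comp_sub (hK : LocallyIntegrable K) (hφ : IsTest U φ) (i : Fin n) :
    pd (fun x => ∫ t, K t * φ (x - t)) i = fun x => ∫ t, K t * pd φ i (x - t) := by
  ext x
  have h1 : ContDiff ℝ 1 φ := hφ.smooth.of_le (by simp)
  have h := hφ.compact.hasFDerivAt_convolution_right (ContinuousLinearMap.mul ℝ ℝ) hK h1 x
  change fderiv ℝ (K ⋆[ContinuousLinearMap.mul ℝ ℝ, volume] φ) x _ = _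
  rw [h.fderiv, convolution_precompR_apply _ hK (hφ.compact.fderiv ℝ)
    (h1.continuous_fderiv one_ne_zero)]
  rfl

lemma integrable_mul_comp_sub (hK : LocallyIntegrable K) (hφ : IsTest U φ) (x : 𝔈 n) :
    Integrable (fun t => K t * φ (x - t)) :=
  hφ.compact.convolutionExists_right (ContinuousLinearMap.mul ℝ ℝ) hK hφ.continuous x

lemma lap_integral_mul_comp_sub (hK : LocallyIntegrable K) (hφ : IsTest U φ) (x : 𝔈 n) :
    lap (fun x => ∫ t, K t * φ (x - t)) x = ∫ t, K t * lap φ (x - t) := by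
  simp_rw [lap, pd_integral_mul_comp_sub hK hφ, pd_integral_mul_comp_sub hK (hφ.pd _),
    Finset.mul_sum]
  rw [integral_finsetSum _ fun k _ => integrable_mul_comp_sub hK ((hφ.pd k).pd k) x]

lemma pd_comp_sub_left (hφ : ContDiff ℝ (⊤ : ℕ∞) φ) (x : 𝔈 n) (i : Fin n) :
    pd (fun t => φ (x - t)) i = fun t => -pd φ i (x - t) := by
  ext t
  have h1 : HasFDerivAt (fun t : 𝔈 n => x - t) (-ContinuousLinearMap.id ℝ (𝔈 n)) t :=
    (hasFDerivAt_id t).const_sub x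
  have h2 := ((hφ.differentiable (by simp) (x - t)).hasFDerivAt.comp t h1).fderiv
  change fderiv ℝ (φ ∘ fun t => x - t) t _ = _
  rw [h2]
  simp [pd]

lemma IsTest.comp_sub_left (hφ : IsTest Set.univ φ) (x : 𝔈 n) :
    IsTest Set.univ (fun t => φ (x - t)) where
  smooth := hφ.smooth.comp (contDiff_const.sub contDiff_id)
  compact := hφ.compact.comp_homeomorph (Homeomorph.subLeft x)
  sub := Set.subset_univ _

lemma lap_comp_sub_left (hφ : ContDiff ℝ (⊤ : ℕ∞) φ) (x t : 𝔈 n) :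
    lap (fun t => φ (x - t)) t = lap φ (x - t) := by
  unfold lap
  refine Finset.sum_congr rfl fun k _ => ?_
  rw [pd_comp_sub_left hφ]
  have h := congrFun (pd_comp_sub_left (hφ.pd k) x k) t
  unfold pd at h ⊢
  rw [fderiv_fun_neg, _root_.neg_apply, h, neg_neg]

lemma lap_integral_newtonKernel_mul (hφ : IsTest Set.univ φ) (j : Fin n) (x : 𝔈 n) :
    lap (fun x => ∫ t, newtonKernel n 0 j t * φ (x - t)) x
      = (∫ x, newtonBump n x) * pd φ j x := by
  rw [lap_integral_mul_comp_sub (locallyIntegrable_newtonKernel 0 j) hφ]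
  have h := integral_newtonKernel_zero_mul_lap j (hφ.comp_sub_left x)
  simp_rw [lap_comp_sub_left hφ.smooth, pd_comp_sub_left hφ.smooth, sub_zero] at h
  rw [h]
  ring

lemma integral_mul_convolution_of_odd (hK : LocallyIntegrable K) (hodd : ∀ x, K (-x) = -K x)
    (hf : IsTest Set.univ f) (hφ : IsTest Set.univ φ) :
    ∫ x, f x * ∫ t, K t * φ (x - t) = -∫ x, (∫ t, K t * f (x - t)) * φ x := by
  have hInt : Integrable (fun p : (𝔈 n) × (𝔈 n) => f p.1 * (φ p.2 * K (p.1 - p.2)))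
      (volume.prod volume) := by
    obtain ⟨R, hR⟩ := (hf.compact.isBounded.union hφ.compact.isBounded).subset_ball 0
    set B := Metric.ball (0 : 𝔈 n) (R + R)
    have hKB : Integrable (B.indicator K) :=
      ((hK.integrableOn_isCompact (isCompact_closedBall 0 (R + R))).mono_set
        Metric.ball_subset_closedBall).integrable_indicator measurableSet_ball
    have hφi : Integrable φ := hφ.continuous.integrable_of_hasCompactSupport hφ.compact
    have h1 := hφi.convolution_integrand (ContinuousLinearMap.mul ℝ ℝ) hKB
    obtain ⟨M, hM⟩ := hf.continuous.bounded_above_of_compact_support hf.compact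
    have h2 := h1.bdd_mul (f := fun p : (𝔈 n) × (𝔈 n) => f p.1) (c := M)
      (hf.continuous.comp continuous_fst).aestronglyMeasurable
      (Filter.Eventually.of_forall fun p => hM p.1)
    refine h2.congr (Filter.Eventually.of_forall fun p => ?_)
    simp only [ContinuousLinearMap.mul_apply']
    by_cases hp1 : p.1 ∈ tsupport f
    · by_cases hp2 : p.2 ∈ tsupport φ
      · have h3 := hR (Or.inl hp1)
        have h4 := hR (Or.inr hp2)
        rw [mem_ball_zero_iff] at h3 h4
        rw [Set.indicator_of_mem]
        rw [mem_ball_zero_iff]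
        linarith [norm_sub_le p.1 p.2]
      · simp [image_eq_zero_of_notMem_tsupport hp2]
    · simp [image_eq_zero_of_notMem_tsupport hp1]
  have h1 : ∀ x, f x * ∫ t, K t * φ (x - t) = ∫ y, f x * (φ y * K (x - y)) := by
    intro x
    rw [integral_const_mul, ← integral_sub_left_eq_self (fun y => φ y * K (x - y)) volume x]
    simp [mul_comm]
  have h2 : ∀ y, (∫ t, K t * f (y - t)) * φ y = -∫ x, f x * (φ y * K (x - y)) := by
    intro y
    rw [← integral_sub_left_eq_self (fun t => f t * (φ y * K (t - y))) volume y,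
      ← integral_mul_const, ← integral_neg]
    congr 1
    ext t
    rw [show y - t - y = -t by abel, hodd]
    ring
  simp_rw [h1, h2, integral_neg, neg_neg]
  exact integral_integral_swap hInt

end Convolution

section Singular

variable {n : ℕ} {U : Set (𝔈 n)} {a : 𝔈 n} {u φ : (𝔈 n) → ℝ}

/-- `u` is a fundamental solution of `-Δ` on `U` with pole `a`, smooth off the pole. -/
structure HasPole (U : Set (𝔈 n)) (a : 𝔈 n) (u : (𝔈 n) → ℝ) : Prop where
  mem : a ∈ U
  smooth : ContDiffOn ℝ (⊤ : ℕ∞) u (U \ {a})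
  locInt : LocallyIntegrableOn u U
  integral_mul_lap : ∀ φ, IsTest U φ → ∫ x, u x * lap φ x = -φ a

lemma IsTest.diff_singleton (hφ : IsTest U φ) (h : φ =ᶠ[nhds a] 0) : IsTest (U \ {a}) φ where
  smooth := hφ.smooth
  compact := hφ.compact
  sub _ hx := ⟨hφ.sub hx, fun hxa => notMem_tsupport_iff_eventuallyEq.2 h (hxa ▸ hx)⟩

lemma exists_isTest_eventuallyEq_one (hU : IsOpen U) (ha : a ∈ U) :
    ∃ η, IsTest U η ∧ η =ᶠ[nhds a] 1 := by
  obtain ⟨r, hr, hrU⟩ := Metric.nhds_basis_closedBall.mem_iff.1 (hU.mem_nhds ha)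
  let b : ContDiffBump a := ⟨r / 2, r, by positivity, by linarith⟩
  exact ⟨b, ⟨b.contDiff, b.hasCompactSupport, b.tsupport_eq.trans_subset hrU⟩,
    b.eventuallyEq_one⟩

lemma pd_eventuallyEq_zero {c : ℝ} (h : φ =ᶠ[nhds a] fun _ => c) (i : Fin n) :
    pd φ i =ᶠ[nhds a] 0 := by
  filter_upwards [h.eventuallyEq_nhds] with x hx
  simp [pd, hx.fderiv_eq]

lemma locallyIntegrable_newtonKernel_comp_sub (j : Fin n) (a : 𝔈 n) :
    LocallyIntegrable (fun x => newtonKernel n 0 j (a - x)) := by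
  have h := locallyIntegrable_map_homeomorph (μ := (volume : Measure (𝔈 n)))
    (f := newtonKernel n 0 j) (Homeomorph.subLeft a)
  have hm : Measure.map (Homeomorph.subLeft a) (volume : Measure (𝔈 n)) = volume :=
    (Measure.measurePreserving_sub_left volume a).map_eq
  rw [hm] at h
  exact h.1 (locallyIntegrable_newtonKernel 0 j)

/-- The cutoff of a fundamental solution has a locally integrable weak derivative. -/
lemma HasPole.exists_weak_pd_mul (hU : IsOpen U) (hu : HasPole U a u) {η : (𝔈 n) → ℝ}
    (hη : IsTest U η) (hη1 : η =ᶠ[nhds a] 1) (j : Fin n) :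
    ∃ V : (𝔈 n) → ℝ, LocallyIntegrable V ∧
      ∀ φ, IsTest Set.univ φ → ∫ x, u x * (pd φ j x * η x) = -∫ x, V x * φ x := by
  have hU' : IsOpen (U \ {a}) := hU.sdiff isClosed_singleton
  set C := ∫ x : 𝔈 n, newtonBump n x
  have hC : 0 < C := integral_newtonBump_pos j.pos.ne'
  have hK := locallyIntegrable_newtonKernel 0 j
  have hdη : ∀ k, IsTest (U \ {a}) (pd η k) := fun k =>
    (hη.pd k).diff_singleton (pd_eventuallyEq_zero hη1 k)
  have hF : ∀ k, IsTest (U \ {a}) (fun x => u x * pd η k x) := fun k =>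
    (hdη k).mul hU' hu.smooth
  have hL : IsTest (U \ {a}) (fun x => u x * lap η x) :=
    (IsTest.sum fun k _ => (hdη k).pd k).mul hU' hu.smooth
  have hS : IsTest (U \ {a}) (fun x => (-2) * ∑ k, pd (fun x => u x * pd η k x) k x) :=
    (IsTest.sum fun k _ => (hF k).pd k).mul hU' contDiffOn_const
  set f := fun x => u x * lap η x + (-2) * ∑ k, pd (fun x => u x * pd η k x) k x with hf_def
  have hf : IsTest Set.univ f := (hL.add hS).mono (Set.subset_univ _)
  refine ⟨fun y => C⁻¹ * (newtonKernel n 0 j (a - y)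
    - ∫ t, newtonKernel n 0 j t * f (y - t)), ?_, fun φ hφ => ?_⟩
  · exact ((locallyIntegrable_newtonKernel_comp_sub j a).sub
      (contDiff_integral_mul_comp_sub hK hf).continuous.locallyIntegrable).smul C⁻¹
  set Θ := fun x => ∫ t, newtonKernel n 0 j t * φ (x - t) with hΘ_def
  have hΘ : ContDiff ℝ (⊤ : ℕ∞) Θ := contDiff_integral_mul_comp_sub hK hφ
  have hΘl : LocallyIntegrableOn Θ Set.univ :=
    hΘ.continuous.locallyIntegrable.locallyIntegrableOn _
  have hΘkl : ∀ k, LocallyIntegrableOn (pd Θ k) Set.univ := fun k =>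
    (hΘ.pd k).continuous.locallyIntegrable.locallyIntegrableOn _
  have huniv : ∀ {ψ}, IsTest (U \ {a}) ψ → IsTest Set.univ ψ := fun h => h.mono (Set.subset_univ _)
  have h1 := hu.integral_mul_lap _ (hη.mul hU hΘ.contDiffOn)
  have h2 : ∀ x, u x * lap (fun x => Θ x * η x) x
      = C * (u x * (pd φ j x * η x))
        + (2 * ∑ k, pd Θ k x * (u x * pd η k x) + Θ x * (u x * lap η x)) := by
    intro x
    rw [lap_mul isOpen_univ hΘ.contDiffOn hη.smooth.contDiffOn (Set.mem_univ x),
      lap_integral_newtonKernel_mul hφ j x]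
    simp only [mul_add, Finset.mul_sum]
    rw [add_assoc]
    congr 1
    · ring
    congr 1
    · exact Finset.sum_congr rfl fun k _ => by ring
    · ring
  have i1 : Integrable fun x => u x * (pd φ j x * η x) :=
    (hη.mul hU (hφ.smooth.pd j).contDiffOn).integrable_mul hU hu.locInt
  have i2 : ∀ k, Integrable fun x => pd Θ k x * (u x * pd η k x) := fun k =>
    (huniv (hF k)).integrable_mul isOpen_univ (hΘkl k)
  have i3 : Integrable fun x => Θ x * (u x * lap η x) :=
    (huniv hL).integrable_mul isOpen_univ hΘl
  have i4 : ∀ k, Integrable fun x => Θ x * pd (fun x => u x * pd η k x) k x := fun k =>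
    ((huniv (hF k)).pd k).integrable_mul isOpen_univ hΘl
  have h3 : ∫ x, (2 * ∑ k, pd Θ k x * (u x * pd η k x) + Θ x * (u x * lap η x))
      = ∫ x, f x * Θ x := by
    have h4 : ∀ x, f x * Θ x
        = (-2) * ∑ k, Θ x * pd (fun x => u x * pd η k x) k x + Θ x * (u x * lap η x) := by
      intro x
      rw [hf_def, ← Finset.mul_sum]
      ring
    simp_rw [h4]
    rw [integral_add ((integrable_finsetSum _ fun k _ => i2 k).const_mul _) i3,
      integral_add ((integrable_finsetSum _ fun k _ => i4 k).const_mul _) i3,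
      integral_const_mul, integral_const_mul, integral_finsetSum _ fun k _ => i2 k,
      integral_finsetSum _ fun k _ => i4 k]
    congr 1
    rw [neg_mul, ← mul_neg, ← Finset.sum_neg_distrib]
    congr 1
    refine Finset.sum_congr rfl fun k _ => ?_
    rw [integral_mul_pd isOpen_univ hΘ.contDiffOn (huniv (hF k)), neg_neg]
  have h5 : Θ a = ∫ y, newtonKernel n 0 j (a - y) * φ y := by
    rw [hΘ_def, ← integral_sub_left_eq_self _ volume a]
    simp
  have i5 : Integrable fun x =>
      2 * ∑ k, pd Θ k x * (u x * pd η k x) + Θ x * (u x * lap η x) :=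
    ((integrable_finsetSum _ fun k _ => i2 k).const_mul _).add i3
  simp_rw [h2] at h1
  rw [integral_add (i1.const_mul _) i5,
    h3, integral_const_mul, hΘ_def,
    integral_mul_convolution_of_odd hK (newtonKernel_neg j 0) hf hφ, ← hΘ_def, hη1.self_of_nhds,
    h5] at h1
  simp_rw [mul_assoc, sub_mul]
  rw [integral_const_mul, integral_sub
    (hφ.integrable_mul isOpen_univ
      ((locallyIntegrable_newtonKernel_comp_sub j a).locallyIntegrableOn _))
    (hφ.integrable_mul isOpen_univ
      ((contDiff_integral_mul_comp_sub hK hf).continuous.locallyIntegrable.locallyIntegrableOn _))]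
  simp only [Pi.one_apply] at h1
  rw [← mul_neg, eq_inv_mul_iff_mul_eq₀ hC.ne']
  linarith

/-- The pointwise gradient of a fundamental solution is locally integrable, and it is the
distributional gradient. -/
lemma HasPole.weak_pd (hU : IsOpen U) (hu : HasPole U a u) (j : Fin n) :
    LocallyIntegrableOn (pd u j) U ∧
      ∀ φ, IsTest U φ → ∫ x, u x * pd φ j x = -∫ x, pd u j x * φ x := by
  have hU' : IsOpen (U \ {a}) := hU.sdiff isClosed_singleton
  have : Nonempty (Fin n) := ⟨j⟩
  have : Nontrivial (𝔈 n) := inferInstance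
  obtain ⟨η, hη, hη1⟩ := exists_isTest_eventuallyEq_one hU hu.mem
  obtain ⟨V, hV, hVφ⟩ := hu.exists_weak_pd_mul hU hη hη1 j
  set g := fun x => (1 - η x) * u x with hg_def
  have hg : ContDiffOn ℝ (⊤ : ℕ∞) g U := by
    intro x hx
    refine ContDiffAt.contDiffWithinAt ?_
    by_cases hxa : x = a
    · subst hxa
      refine (contDiffAt_const (c := (0 : ℝ))).congr_of_eventuallyEq ?_
      filter_upwards [hη1] with y hy
      simp [hg_def, hy]
    · exact (contDiffAt_const.sub hη.smooth.contDiffAt).mul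
        (hu.smooth.contDiffAt (hU'.mem_nhds ⟨hx, hxa⟩))
  have hgl : LocallyIntegrableOn g U := hg.continuousOn.locallyIntegrableOn hU.measurableSet
  have hgl' : LocallyIntegrableOn (pd g j) U :=
    (hg.pd hU j).continuousOn.locallyIntegrableOn hU.measurableSet
  have hW : LocallyIntegrableOn (fun x => V x + pd g j x) U := (hV.locallyIntegrableOn U).add hgl'
  have hweak : ∀ φ, IsTest U φ → ∫ x, u x * pd φ j x = -∫ x, (V x + pd g j x) * φ x := by
    intro φ hφ
    have h1 : ∀ x, u x * pd φ j x = u x * (pd φ j x * η x) + g x * pd φ j x := by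
      intro x
      rw [hg_def]
      ring
    simp_rw [h1, add_mul]
    rw [integral_add ((hη.mul hU (hφ.smooth.pd j).contDiffOn).integrable_mul hU hu.locInt)
        ((hφ.pd j).integrable_mul hU hgl), hVφ φ (hφ.mono (Set.subset_univ _)),
      integral_mul_pd hU hg hφ,
      integral_add (hφ.integrable_mul hU (hV.locallyIntegrableOn U)) (hφ.integrable_mul hU hgl')]
    ring
  have hul : LocallyIntegrableOn (pd u j) (U \ {a}) :=
    (hu.smooth.pd hU' j).continuousOn.locallyIntegrableOn hU'.measurableSet
  have hW' := hW.mono_set (Set.sdiff_subset : U \ {a} ⊆ U)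
  have hae := hU'.ae_eq_zero_of_integral_contDiff_smul_eq_zero (hul.sub hW') (by
    intro ψ h1 h2 h3
    have hψ : IsTest (U \ {a}) ψ := ⟨h1, h2, h3⟩
    have h4 := hweak ψ (hψ.mono Set.sdiff_subset)
    rw [integral_mul_pd hU' hu.smooth hψ] at h4
    simp_rw [Pi.sub_apply, smul_eq_mul, mul_comm (ψ _), sub_mul]
    rw [integral_sub (hψ.integrable_mul hU' hul) (hψ.integrable_mul hU' hW')]
    linarith)
  have hae' : ∀ᵐ x : 𝔈 n, x ∈ U → V x + pd g j x = pd u j x := by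
    filter_upwards [hae, Measure.ae_ne volume a] with x hx hxa hxU
    have := hx ⟨hxU, hxa⟩
    simp only [Pi.sub_apply] at this
    linarith
  refine ⟨?_, fun φ hφ => ?_⟩
  · rw [locallyIntegrableOn_iff hU.isLocallyClosed] at hW ⊢
    intro k hk hkc
    refine (hW k hk hkc).congr_fun_ae ?_
    filter_upwards [ae_restrict_of_ae hae', ae_restrict_mem hkc.measurableSet] with x hx hxk
    exact hx (hk hxk)
  · rw [hweak φ hφ]
    congr 1
    refine integral_congr_ae ?_
    filter_upwards [hae'] with x hx
    by_cases hxU : x ∈ U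
    · simp only [hx hxU]
    · simp [hφ.eq_zero hxU]

lemma HasPole.lap_eq_zero (hU : IsOpen U) (hu : HasPole U a u) :
    Set.EqOn (lap u) 0 (U \ {a}) := by
  have hU' : IsOpen (U \ {a}) := hU.sdiff isClosed_singleton
  have hsm : ∀ k, ContDiffOn ℝ (⊤ : ℕ∞) (pd (pd u k) k) (U \ {a}) := fun k =>
    (hu.smooth.pd hU' k).pd hU' k
  have hc : ContinuousOn (lap u) (U \ {a}) :=
    continuousOn_finsetSum _ fun k _ => (hsm k).continuousOn
  have hae := hU'.ae_eq_zero_of_integral_contDiff_smul_eq_zero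
    (hc.locallyIntegrableOn (μ := volume) hU'.measurableSet) (by
    intro ψ h1 h2 h3
    have hψ : IsTest (U \ {a}) ψ := ⟨h1, h2, h3⟩
    have h4 := hu.integral_mul_lap ψ (hψ.mono Set.sdiff_subset)
    rw [hψ.eq_zero fun h => h.2 rfl, neg_zero] at h4
    simp_rw [lap, Finset.mul_sum] at h4
    rw [integral_finsetSum _ fun k _ => ((hψ.pd k).pd k).integrable_mul hU'
      (hu.smooth.continuousOn.locallyIntegrableOn hU'.measurableSet)] at h4
    simp_rw [lap, smul_eq_mul, Finset.mul_sum, mul_comm (ψ _)]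
    rw [integral_finsetSum _ fun k _ => hψ.integrable_mul hU'
      ((hsm k).continuousOn.locallyIntegrableOn hU'.measurableSet), ← h4]
    refine Finset.sum_congr rfl fun k _ => ?_
    rw [integral_mul_pd hU' hu.smooth (hψ.pd k), integral_mul_pd hU' (hu.smooth.pd hU' k) hψ,
      neg_neg])
  refine Measure.eqOn_open_of_ae_eq (μ := volume) ?_ hU' hc continuousOn_const
  filter_upwards [ae_restrict_of_ae hae, ae_restrict_mem hU'.measurableSet] with x hx hxU
  exact hx hxU

end Singular
section Stress

variable {n : ℕ} {U : Set (𝔈 n)} {a : 𝔈 n} {u v φ : (𝔈 n) → ℝ}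

lemma lap_pd_eq_zero (hU : IsOpen U) (hv : ContDiffOn ℝ (⊤ : ℕ∞) v U)
    (hlap : Set.EqOn (lap v) 0 U) (i : Fin n) : Set.EqOn (lap (pd v i)) 0 U := by
  intro x hx
  have h1 : ∀ k, pd (pd (pd v i) k) k x = pd (pd (pd v k) k) i x := by
    intro k
    rw [pd_congr hU (fun y hy => pd_comm hU hv hy i k) k hx,
      pd_comm hU (hv.pd hU k) hx i k]
  have h2 := pd_congr hU hlap i hx
  have h3 : pd (0 : 𝔈 n → ℝ) i x = 0 := by simp [pd]
  rw [h3] at h2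
  unfold lap at h2 ⊢
  simp_rw [h1]
  rw [pd_sum fun k _ => ((hv.pd hU k).pd hU k).differentiableAt_of_isOpen hU hx] at h2
  exact h2

lemma sum_pd_eq_lap_mul (hU : IsOpen U) (hv : ContDiffOn ℝ (⊤ : ℕ∞) v U)
    (hlap : Set.EqOn (lap v) 0 U) (hφ : IsTest U φ) (i : Fin n) (x : 𝔈 n) :
    ∑ j, (pd (fun y => pd v j y * pd φ j y) i x + pd (fun y => pd v i y * pd φ j y) j x
        - pd (fun y => pd v j y * pd φ i y) j x)
      = lap (fun y => pd v i y * φ y) x := by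
  by_cases hx : x ∈ U
  · have dv : ∀ k, DifferentiableAt ℝ (pd v k) x := fun k =>
      (hv.pd hU k).differentiableAt_of_isOpen hU hx
    have dφ : ∀ k, DifferentiableAt ℝ (pd φ k) x := fun k =>
      ((hφ.pd k).smooth.differentiable (by simp)) x
    have hφU := hφ.smooth.contDiffOn (s := U)
    have h0 : ∑ j, pd (pd v j) j x = 0 := hlap hx
    rw [lap_mul hU (hv.pd hU i) hφU hx, lap_pd_eq_zero hU hv hlap i hx]
    calc _ = ∑ j, (2 * (pd (pd v i) j x * pd φ j x) + pd v i x * pd (pd φ j) j x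
          - pd φ i x * pd (pd v j) j x) := by
          refine Finset.sum_congr rfl fun j _ => ?_
          rw [pd_mul (dv j) (dφ j), pd_mul (dv i) (dφ j), pd_mul (dv j) (dφ i),
            pd_comm hU hv hx j i, pd_comm hU hφU hx j i]
          ring
      _ = _ := by
          rw [Finset.sum_sub_distrib, Finset.sum_add_distrib, ← Finset.mul_sum, ← Finset.mul_sum,
            ← Finset.mul_sum, h0]
          simp [lap]
  · have hA : ∀ k l, IsTest U (fun y => pd v k y * pd φ l y) := fun k l =>
      (hφ.pd l).mul hU (hv.pd hU k)
    rw [(hφ.mul hU (hv.pd hU i)).lap.eq_zero hx]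
    refine Finset.sum_eq_zero fun j _ => ?_
    rw [((hA j j).pd i).eq_zero hx, ((hA i j).pd j).eq_zero hx, ((hA j i).pd j).eq_zero hx]
    ring

/-- The distributional divergence of the polarized energy-momentum tensor of a fundamental solution
and a harmonic function. -/
lemma HasPole.integral_sum_tensor (hU : IsOpen U) (hu : HasPole U a u)
    (hv : ContDiffOn ℝ (⊤ : ℕ∞) v U) (hlap : Set.EqOn (lap v) 0 U) (hφ : IsTest U φ) (i : Fin n) :
    ∫ x, ∑ j, (pd u i x * pd v j x + pd u j x * pd v i x
        - (if i = j then 1 else 0) * ∑ k, pd u k x * pd v k x) * pd φ j x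
      = φ a * pd v i a := by
  have hA : ∀ k l, IsTest U (fun y => pd v k y * pd φ l y) := fun k l =>
    (hφ.pd l).mul hU (hv.pd hU k)
  have hp : ∀ m k l, Integrable fun x => pd u m x * (pd v k x * pd φ l x) := fun m k l =>
    (hA k l).integrable_mul hU (hu.weak_pd hU m).1
  have hq : ∀ m k l, Integrable fun x => u x * pd (fun y => pd v k y * pd φ l y) m x :=
    fun m k l => ((hA k l).pd m).integrable_mul hU hu.locInt
  have h1 : ∀ x, ∑ j, (pd u i x * pd v j x + pd u j x * pd v i x
        - (if i = j then 1 else 0) * ∑ k, pd u k x * pd v k x) * pd φ j x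
      = ∑ j, (pd u i x * (pd v j x * pd φ j x) + pd u j x * (pd v i x * pd φ j x)
        - pd u j x * (pd v j x * pd φ i x)) := by
    intro x
    simp only [sub_mul, add_mul, Finset.sum_sub_distrib, Finset.sum_add_distrib, ite_mul, one_mul,
      zero_mul, Finset.sum_ite_eq, Finset.mem_univ, if_true, mul_assoc, Finset.sum_mul]
  have h2 : ∀ x, u x * lap (fun y => pd v i y * φ y) x
      = ∑ j, (u x * pd (fun y => pd v j y * pd φ j y) i x
        + u x * pd (fun y => pd v i y * pd φ j y) j x
        - u x * pd (fun y => pd v j y * pd φ i y) j x) := by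
    intro x
    rw [← sum_pd_eq_lap_mul hU hv hlap hφ i x, Finset.mul_sum]
    exact Finset.sum_congr rfl fun j _ => by ring
  have h3 := hu.integral_mul_lap _ (hφ.mul hU (hv.pd hU i))
  simp_rw [h2] at h3
  simp_rw [h1]
  have hp' : ∀ j, Integrable fun x => pd u i x * (pd v j x * pd φ j x)
      + pd u j x * (pd v i x * pd φ j x) := fun j => (hp i j j).add (hp j i j)
  have hq' : ∀ j, Integrable fun x => u x * pd (fun y => pd v j y * pd φ j y) i x
      + u x * pd (fun y => pd v i y * pd φ j y) j x := fun j => (hq i j j).add (hq j i j)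
  have hp'' : ∀ j, Integrable fun x => pd u i x * (pd v j x * pd φ j x)
      + pd u j x * (pd v i x * pd φ j x) - pd u j x * (pd v j x * pd φ i x) :=
    fun j => (hp' j).sub (hp j j i)
  have hq'' : ∀ j, Integrable fun x => u x * pd (fun y => pd v j y * pd φ j y) i x
      + u x * pd (fun y => pd v i y * pd φ j y) j x
      - u x * pd (fun y => pd v j y * pd φ i y) j x := fun j => (hq' j).sub (hq j j i)
  rw [integral_finsetSum _ fun j _ => hq'' j] at h3
  rw [integral_finsetSum _ fun j _ => hp'' j, mul_comm (φ a),
    neg_eq_iff_eq_neg.1 h3.symm, ← Finset.sum_neg_distrib]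
  refine Finset.sum_congr rfl fun j _ => ?_
  rw [integral_sub (hq' j) (hq j j i), integral_add (hq i j j) (hq j i j),
    integral_sub (hp' j) (hp j j i), integral_add (hp i j j) (hp j i j),
    (hu.weak_pd hU i).2 _ (hA j j), (hu.weak_pd hU j).2 _ (hA i j),
    (hu.weak_pd hU j).2 _ (hA j i)]
  ring

lemma IsGreen.hasPole {Ω V : Set (𝔈 n)} {G : 𝔈 n → 𝔈 n → ℝ} (hG : IsGreen n Ω G) (hV : V ⊆ Ω)
    (ha : a ∈ V) : HasPole V a (fun x => G x a) where
  mem := ha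
  smooth := (hG.smooth a (hV ha)).mono (Set.sdiff_subset_sdiff_left hV)
  locInt := (hG.locInt a (hV ha)).mono_set hV
  integral_mul_lap φ hφ := by
    rw [← hG.distrib a (hV ha) φ hφ.smooth hφ.compact (hφ.sub.trans hV)]
    refine (setIntegral_eq_integral_of_forall_compl_eq_zero fun x hx => ?_).symm
    rw [(hφ.mono hV).lap.eq_zero hx, mul_zero]

end Stress

/-- the distributional divergence of the polarized energy-momentum tensor
`T i j = ∂ᵢG(·,a) ∂ⱼG(·,b) + ∂ⱼG(·,a) ∂ᵢG(·,b) − δᵢⱼ ⟨∇G(·,a), ∇G(·,b)⟩` has exactly the two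
point sources `−∂ᵢG(·,a)(b) δ_b − ∂ᵢG(·,b)(a) δ_a`: tested against any smooth compactly
supported `φ`, `∫_Ω ∑ⱼ T i j ∂ⱼφ = φ(b) ∂ᵢG(·,a)(b) + φ(a) ∂ᵢG(·,b)(a)`. -/
theorem energy_momentum_tensor_distributional_divergence
    {n : ℕ} (hn : 2 ≤ n) (Ω : Set (EuclideanSpace ℝ (Fin n)))
    (hΩo : IsOpen Ω) (hΩb : Bornology.IsBounded Ω)
    (G : EuclideanSpace ℝ (Fin n) → EuclideanSpace ℝ (Fin n) → ℝ)
    (hG : IsGreen n Ω G)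
    (a b : EuclideanSpace ℝ (Fin n)) (ha : a ∈ Ω) (hb : b ∈ Ω) (hab : a ≠ b)
    (T : Fin n → Fin n → EuclideanSpace ℝ (Fin n) → ℝ)
    (hT : ∀ i j x, T i j x
        = pd (fun y => G y a) i x * pd (fun y => G y b) j x
        + pd (fun y => G y a) j x * pd (fun y => G y b) i x
        - (if i = j then 1 else 0) * ∑ k, pd (fun y => G y a) k x * pd (fun y => G y b) k x)
    (hTloc : ∀ i j, LocallyIntegrableOn (T i j) Ω volume) :
    ∀ i : Fin n, ∀ φ : EuclideanSpace ℝ (Fin n) → ℝ,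
      ContDiff ℝ (⊤ : ℕ∞) φ → HasCompactSupport φ → tsupport φ ⊆ Ω →
      (∫ x in Ω, ∑ j, T i j x * pd φ j x)
        = φ b * pd (fun y => G y a) i b + φ a * pd (fun y => G y b) i a := by
  intro i φ hφs hφc hφΩ
  have hφ : IsTest Ω φ := ⟨hφs, hφc, hφΩ⟩
  have hoa : IsOpen (Ω \ {a}) := hΩo.sdiff isClosed_singleton
  have hob : IsOpen (Ω \ {b}) := hΩo.sdiff isClosed_singleton
  obtain ⟨χ, hχ, hχ1⟩ := exists_isTest_eventuallyEq_one hoa (⟨hb, hab.symm⟩ : b ∈ Ω \ {a})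
  have hφa : IsTest (Ω \ {b}) (fun x => (1 - χ x) * φ x) := by
    refine (hφ.mul hΩo (contDiff_const.sub hχ.smooth).contDiffOn).diff_singleton ?_
    filter_upwards [hχ1] with x hx
    simp [hx]
  have hφb : IsTest (Ω \ {a}) (fun x => φ x * χ x) := hχ.mul hoa hφs.contDiffOn
  have h1 := (hG.hasPole Set.sdiff_subset (⟨ha, hab⟩ : a ∈ Ω \ {b})).integral_sum_tensor hob
    (hG.smooth b hb) ((hG.hasPole subset_rfl hb).lap_eq_zero hΩo) hφa i
  have h2 := (hG.hasPole Set.sdiff_subset (⟨hb, hab.symm⟩ : b ∈ Ω \ {a})).integral_sum_tensor hoa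
    (hG.smooth a ha) ((hG.hasPole subset_rfl ha).lap_eq_zero hΩo) hφb i
  have e1 : ∀ x, ∑ j, T i j x * pd φ j x
      = ∑ j, T i j x * pd (fun x => (1 - χ x) * φ x) j x
        + ∑ j, T i j x * pd (fun x => φ x * χ x) j x := by
    intro x
    rw [← Finset.sum_add_distrib]
    refine Finset.sum_congr rfl fun j _ => ?_
    rw [← mul_add, ← pd_add (hφa.smooth.differentiable (by simp) x)
      (hφb.smooth.differentiable (by simp) x)]
    congr 3
    ext y
    ring
  have e2 : ∀ x, ∑ j, T i j x * pd (fun x => φ x * χ x) j x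
      = ∑ j, (pd (fun y => G y b) i x * pd (fun y => G y a) j x
        + pd (fun y => G y b) j x * pd (fun y => G y a) i x
        - (if i = j then 1 else 0) * ∑ k, pd (fun y => G y b) k x * pd (fun y => G y a) k x)
          * pd (fun x => φ x * χ x) j x := by
    intro x
    refine Finset.sum_congr rfl fun j _ => ?_
    simp only [hT, mul_comm (pd (fun y => G y b) _ x)]
    ring
  have hInt : ∀ ψ, IsTest Ω ψ → Integrable fun x => ∑ j, T i j x * pd ψ j x := fun ψ hψ =>
    integrable_finsetSum _ fun j _ => (hψ.pd j).integrable_mul hΩo (hTloc i j)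
  rw [setIntegral_eq_integral_of_forall_compl_eq_zero fun x hx =>
    Finset.sum_eq_zero fun j _ => by rw [(hφ.pd j).eq_zero hx, mul_zero]]
  simp_rw [e1]
  rw [integral_add (hInt _ (hφa.mono Set.sdiff_subset)) (hInt _ (hφb.mono Set.sdiff_subset))]
  simp_rw [e2, hT, h1, h2, hχ1.self_of_nhds, hχ.eq_zero (fun h => h.2 rfl : a ∉ Ω \ {a})]
  simp
  ring
end

section
/- Let v : ℝ^n → ℝ^n be a continuously differentiable vector field and let φ : ℝ × ℝ^n → ℝ^n be continuously differentiable with φ(0,·) = id, ∂_t φ(t,x) = v(φ(t,x)) for all t, x, and such that for each t the map φ_t := φ(t,·) is a bijection of ℝ^n whose inverse is continuously differentiable. Let Ω ⊂ ℝ^n be a bounded open set and let f : ℝ^n → ℝ be continuously differentiable with compact support. Then the function t ↦ ∫_{φ_t(Ω)} f(x) dx is differentiable and for each t its derivative equals ∫_{φ_t(Ω)} div(f v)(x) dx, where div(f v) = ∑_{j=1}^n ∂_j (f v_j). -/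
open MeasureTheory
open scoped BigOperators

section FlowTransport

open Set Filter Topology

theorem hasFDerivAt_intervalIntegral_of_continuous {E F : Type*}
    [NormedAddCommGroup E] [NormedSpace ℝ E] [ProperSpace E]
    [NormedAddCommGroup F] [NormedSpace ℝ F]
    {G : ℝ → E → F} {G' : ℝ → E → E →L[ℝ] F}
    (hG : ∀ x, Continuous fun r => G r x)
    (hG' : Continuous fun p : ℝ × E => G' p.1 p.2)
    (hderiv : ∀ r x, HasFDerivAt (G r) (G' r x) x) (a b : ℝ) (x : E) :
    HasFDerivAt (fun y => ∫ r in a..b, G r y) (∫ r in a..b, G' r x) x := by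
  obtain ⟨C, hC⟩ := (isCompact_uIcc (a := a) (b := b)).prod (isCompact_closedBall x 1)
    |>.exists_bound_of_continuousOn hG'.continuousOn
  refine intervalIntegral.hasFDerivAt_integral_of_dominated_of_fderiv_le (bound := fun _ => C)
    (Metric.closedBall_mem_nhds x one_pos)
    (Eventually.of_forall fun y => (hG y).aestronglyMeasurable)
    ((hG x).intervalIntegrable _ _)
    (hG'.comp (by fun_prop : Continuous fun r : ℝ => (r, x))).aestronglyMeasurable
    (Eventually.of_forall fun r hr y hy => hC (r, y) ⟨uIoc_subset_uIcc hr, hy⟩)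
    intervalIntegrable_const (Eventually.of_forall fun r _ y _ => hderiv r y)

theorem Matrix.hasDerivAt_det_of_eq_one {ι : Type*} [Fintype ι] [DecidableEq ι]
    {A : ℝ → ι → ι → ℝ} {A' : ι → ι → ℝ} {t : ℝ}
    (hA : HasDerivAt A A' t) (h1 : A t = (1 : Matrix ι ι ℝ)) :
    HasDerivAt (fun s => Matrix.det (Matrix.of (A s))) (Matrix.trace (Matrix.of A')) t := by
  let d : ContinuousMultilinearMap ℝ (fun _ : ι => ι → ℝ) ℝ :=
    ⟨(Matrix.detRowAlternating (n := ι) (R := ℝ)).toMultilinearMap,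
      show Continuous fun M : Matrix ι ι ℝ => M.det from continuous_id.matrix_det⟩
  have h := (d.hasFDerivAt (A t)).comp_hasDerivAt t hA
  refine h.congr_deriv ?_
  rw [ContinuousMultilinearMap.linearDeriv_apply, Matrix.trace]
  refine Finset.sum_congr rfl fun i _ => ?_
  change Matrix.det (Matrix.updateRow (A t) i (A' i)) = A' i i
  rw [h1, ← Matrix.cramer_transpose_apply]
  simp

theorem ContinuousLinearMap.hasDerivAt_det_of_eq_one {E : Type*} [NormedAddCommGroup E]
    [NormedSpace ℝ E] [FiniteDimensional ℝ E] {B : ℝ → E →L[ℝ] E} {B' : E →L[ℝ] E} {t : ℝ}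
    (hB : HasDerivAt B B' t) (h1 : B t = 1) :
    HasDerivAt (fun s => (B s).det) (LinearMap.trace ℝ E B') t := by
  let b := Module.finBasis ℝ E
  have hM : HasDerivAt (fun s i j => LinearMap.toMatrix b b (B s : E →ₗ[ℝ] E) i j)
      (fun i j => LinearMap.toMatrix b b (B' : E →ₗ[ℝ] E) i j) t := by
    refine hasDerivAt_pi.2 fun i => hasDerivAt_pi.2 fun j => ?_
    simp only [LinearMap.toMatrix_apply]
    have h := hB.clm_apply (hasDerivAt_const t (b j))
    simp only [map_zero, add_zero] at h
    exact (LinearMap.toContinuousLinearMap (b.coord i)).hasFDerivAt.comp_hasDerivAt t h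
  have h := Matrix.hasDerivAt_det_of_eq_one hM (by
    rw [h1]
    exact LinearMap.toMatrix_one b)
  rw [LinearMap.trace_eq_matrix_trace ℝ b]
  refine h.congr_of_eventuallyEq (Eventually.of_forall fun s => ?_)
  exact (LinearMap.det_toMatrix b (B s : E →ₗ[ℝ] E)).symm

/-- Liouville's formula for the linear equation `A' = L A`. -/
theorem ContinuousLinearMap.hasDerivAt_det_of_hasDerivAt_mul {E : Type*} [NormedAddCommGroup E]
    [NormedSpace ℝ E] [FiniteDimensional ℝ E] {A : ℝ → E →L[ℝ] E} {L C : E →L[ℝ] E} {t : ℝ}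
    (hA : HasDerivAt A (L * A t) t) (hC : A t * C = 1) (hC' : C * A t = 1) :
    HasDerivAt (fun s => (A s).det) (LinearMap.trace ℝ E L * (A t).det) t := by
  have hB : HasDerivAt (fun s => A s * C) L t := by
    simpa [mul_assoc, hC] using hA.mul_const C
  refine ((ContinuousLinearMap.hasDerivAt_det_of_eq_one hB hC).mul_const
    (A t).det).congr_of_eventuallyEq (Eventually.of_forall fun s => ?_)
  have : A s = A s * C * A t := by rw [mul_assoc, hC', mul_one]
  change (A s).det = _
  conv_lhs => rw [this]
  exact LinearMap.det_comp ((A s * C : E →L[ℝ] E) : E →ₗ[ℝ] E) (A t : E →ₗ[ℝ] E)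

theorem hasDerivAt_abs_of_mul {J : ℝ → ℝ} {c t : ℝ} (hJ : HasDerivAt J (c * J t) t)
    (h0 : J t ≠ 0) : HasDerivAt (fun s => |J s|) (c * |J t|) t := by
  have h := (hasDerivAt_abs h0).comp t hJ
  refine h.congr_deriv ?_
  rw [mul_left_comm, sign_mul_self]

theorem hasDerivAt_integral_of_continuous_of_isBounded {E : Type*} [NormedAddCommGroup E]
    [ProperSpace E] [MeasurableSpace E] [BorelSpace E] (μ : Measure E) [IsFiniteMeasureOnCompacts μ] {Ω : Set E}
    (hΩ : Bornology.IsBounded Ω) {F F' : ℝ → E → ℝ}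
    (hF : Continuous fun p : ℝ × E => F p.1 p.2) (hF' : Continuous fun p : ℝ × E => F' p.1 p.2)
    (hderiv : ∀ t x, HasDerivAt (fun s => F s x) (F' t x) t) (t : ℝ) :
    HasDerivAt (fun s => ∫ x in Ω, F s x ∂μ) (∫ x in Ω, F' t x ∂μ) t := by
  have hK := hΩ.isCompact_closure
  have hcont (s : ℝ) {H : ℝ → E → ℝ} (hH : Continuous fun p : ℝ × E => H p.1 p.2) :
      Continuous (H s) := hH.comp (by fun_prop : Continuous fun x : E => (s, x))
  have hint {g : E → ℝ} (hg : Continuous g) : IntegrableOn g Ω μ :=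
    (hg.continuousOn.integrableOn_compact hK).mono_set subset_closure
  obtain ⟨C, hC⟩ := (isCompact_closedBall t 1).prod hK
    |>.exists_bound_of_continuousOn hF'.continuousOn
  have hb : ∀ᵐ x ∂μ.restrict Ω, x ∈ closure Ω :=
    ae_mono (Measure.restrict_mono subset_closure le_rfl)
      (ae_restrict_mem isClosed_closure.measurableSet)
  refine (hasDerivAt_integral_of_dominated_loc_of_deriv_le (bound := fun _ => C)
    (Metric.closedBall_mem_nhds t one_pos)
    (Eventually.of_forall fun s => (hcont s hF).aestronglyMeasurable)
    (hint (hcont t hF)) (hcont t hF').aestronglyMeasurable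
    (hb.mono fun x hx s hs => hC (s, x) ⟨hs, hx⟩) (hint continuous_const)
    (Eventually.of_forall fun x s _ => hderiv s x)).2

variable {E : Type*} [NormedAddCommGroup E] [NormedSpace ℝ E]

/-- The spatial derivative of a time-dependent map. -/
noncomputable def spatialFDeriv (φ : ℝ → E → E) (t : ℝ) (x : E) : E →L[ℝ] E :=
  (fderiv ℝ (fun p : ℝ × E => φ p.1 p.2) (t, x)).comp (ContinuousLinearMap.inr ℝ ℝ E)

theorem hasFDerivAt_spatialFDeriv {φ : ℝ → E → E}
    (hφ : ContDiff ℝ 1 fun p : ℝ × E => φ p.1 p.2) (t : ℝ) (x : E) :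
    HasFDerivAt (φ t) (spatialFDeriv φ t x) x :=
  ((hφ.differentiable one_ne_zero (t, x)).hasFDerivAt).comp x (hasFDerivAt_prodMk_right t x)

theorem continuous_spatialFDeriv {φ : ℝ → E → E}
    (hφ : ContDiff ℝ 1 fun p : ℝ × E => φ p.1 p.2) :
    Continuous fun p : ℝ × E => spatialFDeriv φ p.1 p.2 :=
  (hφ.continuous_fderiv one_ne_zero).clm_comp continuous_const

/-- The variational equation of a `C¹` flow. -/
theorem hasDerivAt_spatialFDeriv [FiniteDimensional ℝ E] {v : E → E} (hv : ContDiff ℝ 1 v)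
    {φ : ℝ → E → E} (hφ : ContDiff ℝ 1 fun p : ℝ × E => φ p.1 p.2)
    (hflow : ∀ t x, HasDerivAt (fun s => φ s x) (v (φ t x)) t) (t : ℝ) (x : E) :
    HasDerivAt (fun s => spatialFDeriv φ s x)
      (fderiv ℝ v (φ t x) * spatialFDeriv φ t x) t := by
  have : ProperSpace E := FiniteDimensional.proper ℝ E
  let G' : ℝ → E → E →L[ℝ] E := fun r y => fderiv ℝ v (φ r y) * spatialFDeriv φ r y
  have hφx (y : E) : Continuous fun r => φ r y :=
    hφ.continuous.comp (by fun_prop : Continuous fun r : ℝ => (r, y))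
  have hG' : Continuous fun p : ℝ × E => G' p.1 p.2 :=
    ((hv.continuous_fderiv one_ne_zero).comp hφ.continuous).mul (continuous_spatialFDeriv hφ)
  have hG'x : Continuous fun r => G' r x :=
    hG'.comp (by fun_prop : Continuous fun r : ℝ => (r, x))
  have hint (s : ℝ) : spatialFDeriv φ s x = spatialFDeriv φ t x + ∫ r in t..s, G' r x := by
    have h := (hasFDerivAt_spatialFDeriv hφ t x).add
      (hasFDerivAt_intervalIntegral_of_continuous (G := fun r y => v (φ r y))
        (fun y => hv.continuous.comp (hφx y)) hG'
        (fun r y => ((hv.differentiable one_ne_zero _).hasFDerivAt).comp y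
          (hasFDerivAt_spatialFDeriv hφ r y)) t s x)
    refine (hasFDerivAt_spatialFDeriv hφ s x).unique
      (h.congr_of_eventuallyEq (Eventually.of_forall fun y => ?_))
    have := intervalIntegral.integral_eq_sub_of_hasDerivAt (fun r _ => hflow r y)
      ((hv.continuous.comp (hφx y)).intervalIntegrable t s)
    simp [this]
  have h := (intervalIntegral.integral_hasDerivAt_right (hG'x.intervalIntegrable t t)
    (hG'x.stronglyMeasurableAtFilter _ _) hG'x.continuousAt).const_add (spatialFDeriv φ t x)
  exact h.congr_of_eventuallyEq (Eventually.of_forall hint)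

theorem hasDerivAt_setIntegral_image_flow [FiniteDimensional ℝ E] [MeasurableSpace E]
    [BorelSpace E] (μ : Measure E) [μ.IsAddHaarMeasure] {v : E → E} (hv : ContDiff ℝ 1 v)
    {φ : ℝ → E → E} (hφ : ContDiff ℝ 1 fun p : ℝ × E => φ p.1 p.2)
    (hflow : ∀ t x, HasDerivAt (fun s => φ s x) (v (φ t x)) t)
    (hinv : ∀ t, ∃ ψ : E → E, ContDiff ℝ 1 ψ ∧
      Function.LeftInverse ψ (φ t) ∧ Function.RightInverse ψ (φ t))
    {Ω : Set E} (hΩm : MeasurableSet Ω) (hΩb : Bornology.IsBounded Ω)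
    {f : E → ℝ} (hf : ContDiff ℝ 1 f) (t : ℝ) :
    HasDerivAt (fun s => ∫ x in φ s '' Ω, f x ∂μ)
      (∫ x in φ t '' Ω, (f x * LinearMap.trace ℝ E (fderiv ℝ v x) + fderiv ℝ f x (v x)) ∂μ) t := by
  have : ProperSpace E := FiniteDimensional.proper ℝ E
  have hchange (s : ℝ) (g : E → ℝ) : ∫ x in φ s '' Ω, g x ∂μ =
      ∫ x in Ω, |(spatialFDeriv φ s x).det| * g (φ s x) ∂μ := by
    obtain ⟨ψ, -, hψ, -⟩ := hinv s
    exact integral_image_eq_integral_abs_det_fderiv_smul μ hΩm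
      (fun x _ => (hasFDerivAt_spatialFDeriv hφ s x).hasFDerivWithinAt) hψ.injective.injOn g
  have hJ (s : ℝ) (x : E) : HasDerivAt (fun r => |(spatialFDeriv φ r x).det|)
      (LinearMap.trace ℝ E (fderiv ℝ v (φ s x)) * |(spatialFDeriv φ s x).det|) s := by
    obtain ⟨ψ, hψ1, hψl, hψr⟩ := hinv s
    have hψd (y : E) := (hψ1.differentiable one_ne_zero y).hasFDerivAt
    have hl : fderiv ℝ ψ (φ s x) * spatialFDeriv φ s x = 1 :=
      ((hψd (φ s x)).comp x (hasFDerivAt_spatialFDeriv hφ s x)).unique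
        ((hasFDerivAt_id x).congr_of_eventuallyEq (Eventually.of_forall hψl))
    have hr : spatialFDeriv φ s x * fderiv ℝ ψ (φ s x) = 1 :=
      (HasFDerivAt.comp (φ s x) (by simpa [hψl x] using hasFDerivAt_spatialFDeriv hφ s x)
        (hψd (φ s x))).unique
          ((hasFDerivAt_id (φ s x)).congr_of_eventuallyEq (Eventually.of_forall hψr))
    refine hasDerivAt_abs_of_mul (ContinuousLinearMap.hasDerivAt_det_of_hasDerivAt_mul
      (hasDerivAt_spatialFDeriv hv hφ hflow s x) hr hl) fun h0 => ?_
    have hdet : (fderiv ℝ ψ (φ s x)).det * (spatialFDeriv φ s x).det = 1 := by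
      have h := LinearMap.det_comp (fderiv ℝ ψ (φ s x) : E →ₗ[ℝ] E)
        (spatialFDeriv φ s x : E →ₗ[ℝ] E)
      refine h.symm.trans ?_
      change ContinuousLinearMap.det (fderiv ℝ ψ (φ s x) * spatialFDeriv φ s x) = 1
      rw [hl]
      exact LinearMap.det_id
    simp [h0] at hdet
  have hJc : Continuous fun p : ℝ × E => |(spatialFDeriv φ p.1 p.2).det| :=
    (ContinuousLinearMap.continuous_det.comp (continuous_spatialFDeriv hφ)).abs
  have hdivc : Continuous fun y => LinearMap.trace ℝ E (fderiv ℝ v y) :=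
    (LinearMap.continuous_of_finiteDimensional
      (LinearMap.trace ℝ E ∘ₗ ContinuousLinearMap.coeLM ℝ)).comp
        (hv.continuous_fderiv one_ne_zero)
  have hgc : Continuous fun y => f y * LinearMap.trace ℝ E (fderiv ℝ v y) + fderiv ℝ f y (v y) :=
    (hf.continuous.mul hdivc).add ((hf.continuous_fderiv one_ne_zero).clm_apply hv.continuous)
  simp only [hchange]
  refine hasDerivAt_integral_of_continuous_of_isBounded μ hΩb
    (F' := fun s x => |(spatialFDeriv φ s x).det| * (f (φ s x) *
      LinearMap.trace ℝ E (fderiv ℝ v (φ s x)) + fderiv ℝ f (φ s x) (v (φ s x))))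
    (hJc.mul (hf.continuous.comp hφ.continuous)) (hJc.mul (hgc.comp hφ.continuous))
    (fun s x => ?_) t
  have h := (hJ s x).mul
    (((hf.differentiable one_ne_zero (φ s x)).hasFDerivAt).comp_hasDerivAt s (hflow s x))
  refine h.congr_deriv ?_
  simp only [Function.comp_apply]
  ring

theorem sum_pd_mul_eq {n : ℕ} {v : EuclideanSpace ℝ (Fin n) → EuclideanSpace ℝ (Fin n)}
    {f : EuclideanSpace ℝ (Fin n) → ℝ} {x : EuclideanSpace ℝ (Fin n)}
    (hv : DifferentiableAt ℝ v x) (hf : DifferentiableAt ℝ f x) :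
    ∑ j, pd (fun y => f y * v y j) j x =
      f x * LinearMap.trace ℝ (EuclideanSpace ℝ (Fin n)) (fderiv ℝ v x) + fderiv ℝ f x (v x) := by
  have hpd (j : Fin n) : pd (fun y => f y * v y j) j x =
      f x * fderiv ℝ v x (EuclideanSpace.single j 1) j +
        v x j * fderiv ℝ f x (EuclideanSpace.single j 1) := by
    have hvj : HasFDerivAt (fun y => v y j)
        ((EuclideanSpace.proj j : EuclideanSpace ℝ (Fin n) →L[ℝ] ℝ).comp (fderiv ℝ v x)) x :=
      (EuclideanSpace.proj j : EuclideanSpace ℝ (Fin n) →L[ℝ] ℝ).hasFDerivAt.comp x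
        hv.hasFDerivAt
    have h : HasFDerivAt (fun y => f y * v y j) _ x := hf.hasFDerivAt.mul hvj
    rw [pd, h.fderiv]
    simp
  have hvx : v x = ∑ j, v x j • EuclideanSpace.single j (1 : ℝ) := by
    simpa using ((EuclideanSpace.basisFun (Fin n) ℝ).sum_repr (v x)).symm
  simp only [hpd, Finset.sum_add_distrib, ← Finset.mul_sum]
  congr 1
  · rw [LinearMap.trace_eq_sum_inner _ (EuclideanSpace.basisFun (Fin n) ℝ)]
    simp [EuclideanSpace.inner_single_left]
  · conv_rhs => rw [hvx]
    simp

end FlowTransport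

/-- transport theorem.  If `φ` is the (jointly `C¹`, `C¹`-invertible) flow of a
`C¹` vector field `v`, `Ω ⊂ ℝ^n` is a bounded open set and `f` is `C¹` with compact support,
then `t ↦ ∫_{φ_t(Ω)} f` is differentiable with derivative `∫_{φ_t(Ω)} div(f v)`. -/
theorem deriv_integral_over_flow_image
    {n : ℕ} (v : EuclideanSpace ℝ (Fin n) → EuclideanSpace ℝ (Fin n))
    (hv : ContDiff ℝ 1 v)
    (φ : ℝ → EuclideanSpace ℝ (Fin n) → EuclideanSpace ℝ (Fin n))
    (hφC1 : ContDiff ℝ 1 (fun p : ℝ × EuclideanSpace ℝ (Fin n) => φ p.1 p.2))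
    (hφ0 : φ 0 = id)
    (hflow : ∀ (t : ℝ) (x : EuclideanSpace ℝ (Fin n)),
      HasDerivAt (fun s => φ s x) (v (φ t x)) t)
    (hinv : ∀ t : ℝ, ∃ ψ : EuclideanSpace ℝ (Fin n) → EuclideanSpace ℝ (Fin n),
      ContDiff ℝ 1 ψ ∧ Function.LeftInverse ψ (φ t) ∧ Function.RightInverse ψ (φ t))
    (Ω : Set (EuclideanSpace ℝ (Fin n))) (hΩo : IsOpen Ω) (hΩb : Bornology.IsBounded Ω)
    (f : EuclideanSpace ℝ (Fin n) → ℝ) (hf : ContDiff ℝ 1 f) (hfc : HasCompactSupport f) :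
    ∀ t : ℝ, HasDerivAt (fun s => ∫ x in φ s '' Ω, f x)
      (∫ x in φ t '' Ω, ∑ j, pd (fun y => f y * v y j) j x) t := by
  intro t
  simp only [fun x => sum_pd_mul_eq (hv.differentiable one_ne_zero x)
    (hf.differentiable one_ne_zero x)]
  exact hasDerivAt_setIntegral_image_flow volume hv hφC1 hflow hinv hΩo.measurableSet hΩb hf t
end
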